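/- Let N, L be positive integers and let T ∈ ℂ^{NL×NL} be a positive semidefinite Toeplitz-block-Toeplitz matrix. Let σ be the smallest eigenvalue of T and let K = rank(T − σI). If K ≤ min{N, L}, then there exist K pairwise distinct pairs (f_1, θ_1), …, (f_K, θ_K) ∈ [0,1) × [0,1) and positive reals p_1, …, p_K such that T = Σ_{k=1}^K p_k (v_L(f_k) v_L(f_k)ᴴ) ⊗ (v_N(θ_k) v_N(θ_k)ᴴ) + σI. (Multiple Vandermonde decomposition, existence part of Theorem 1.) -/

import Mathlib

open Matrix Complex
open scoped Kronecker ComplexOrder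

/-- The steering vector `v_m(f) ∈ ℂ^m` with `j`-th entry `exp(2πi·j·f)`, `j = 0,…,m−1`. -/
noncomputable def steer (m : ℕ) (f : ℝ) : Fin m → ℂ :=
  fun j => Complex.exp (2 * (Real.pi : ℂ) * Complex.I * (j : ℕ) * (f : ℝ))

/-- The rank-one outer product `v_m(f) v_m(f)ᴴ`. -/
noncomputable def steerMat (m : ℕ) (f : ℝ) : Matrix (Fin m) (Fin m) ℂ :=
  Matrix.vecMulVec (steer m f) (star (steer m f))

/-- A matrix indexed by pairs `(l,n)` is Toeplitz-block-Toeplitz if its entry at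
`((l,n),(l',n'))` depends only on the differences `l−l'` and `n−n'`. -/
def IsToeplitzBlockToeplitz {L N : ℕ}
    (T : Matrix (Fin L × Fin N) (Fin L × Fin N) ℂ) : Prop :=
  ∀ i j i' j' : Fin L × Fin N,
    ((i.1 : ℤ) - (j.1 : ℤ) = (i'.1 : ℤ) - (j'.1 : ℤ)) →
    ((i.2 : ℤ) - (j.2 : ℤ) = (i'.2 : ℤ) - (j'.2 : ℤ)) →
    T i j = T i' j'

open Module

section MVD
variable {E : Type*} [NormedAddCommGroup E] [InnerProductSpace ℂ E] [FiniteDimensional ℂ E]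

lemma mvd_eig (Q : Submodule ℂ E) (hQ : Q ≠ ⊥) (f : E →ₗ[ℂ] E) (hf : ∀ v ∈ Q, f v ∈ Q) :
    ∃ z : ℂ, ∃ u ∈ Q, u ≠ 0 ∧ f u = z • u := by
  have : Nontrivial Q := Submodule.nontrivial_iff_ne_bot.mpr hQ
  obtain ⟨c, hc⟩ := Module.End.exists_eigenvalue (f.restrict hf)
  obtain ⟨v, hv⟩ := hc.exists_hasEigenvector
  refine ⟨c, v, v.2, ?_, ?_⟩
  · simpa using hv.2
  · have := hv.apply_eq_smul
    simpa using congrArg Subtype.val this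

lemma mvd_common (Q : Submodule ℂ E) (hQ : Q ≠ ⊥) (f g : E →ₗ[ℂ] E) (hf : ∀ v ∈ Q, f v ∈ Q)
    (hg : ∀ v ∈ Q, g v ∈ Q) (hc : ∀ v, f (g v) = g (f v)) :
    ∃ z w : ℂ, ∃ u ∈ Q, u ≠ 0 ∧ f u = z • u ∧ g u = w • u := by
  obtain ⟨z, u, hu, hu0, hfu⟩ := mvd_eig Q hQ f hf
  obtain ⟨w, u', hu', hu0', hgu⟩ := mvd_eig (Q ⊓ Module.End.eigenspace f z)
    (by
      intro h
      apply hu0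
      rw [← Submodule.mem_bot ℂ, ← h]
      exact ⟨hu, Module.End.mem_eigenspace_iff.mpr hfu⟩) g
    (by
      rintro v ⟨h1, h2⟩
      refine ⟨hg v h1, Module.End.mem_eigenspace_iff.mpr ?_⟩
      rw [hc, Module.End.mem_eigenspace_iff.mp h2, map_smul])
  exact ⟨z, w, u', hu'.1, hu0', Module.End.mem_eigenspace_iff.mp hu'.2, hgu⟩

lemma mvd_orth_inv (U : E ≃ₗᵢ[ℂ] E) (e v : E) (z : ℂ) (he : U e = z • e) (he0 : ‖e‖ = 1)
    (h : inner ℂ e v = 0) : inner ℂ e (U v) = 0 := by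
  have h1 : inner ℂ (U e) (U v) = 0 := by rw [U.inner_map_map, h]
  have h2 : ‖z‖ = 1 := by
    have := congrArg norm he
    rw [U.norm_map, norm_smul, he0] at this
    linarith
  rw [he, inner_smul_left] at h1
  rcases mul_eq_zero.mp h1 with h3 | h3
  · rw [map_eq_zero] at h3
    simp [h3] at h2
  · exact h3

lemma mvd_diag_aux (U V : E ≃ₗᵢ[ℂ] E) (hc : ∀ v, U (V v) = V (U v)) (k : ℕ)
    (hk : k ≤ finrank ℂ E) : ∃ (e : Fin k → E), Orthonormal ℂ e ∧
      ∀ i, (∃ z : ℂ, U (e i) = z • e i) ∧ (∃ z : ℂ, V (e i) = z • e i) := by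
  induction k with
  | zero => exact ⟨fun i => i.elim0, ⟨fun i => i.elim0, fun i => i.elim0⟩, fun i => i.elim0⟩
  | succ k ih =>
    obtain ⟨e, he, hev⟩ := ih (by omega)
    let P := Submodule.span ℂ (Set.range e)
    have hP : finrank ℂ P = k := by
      simpa using finrank_span_eq_card he.linearIndependent
    have hmem : ∀ v, v ∈ Pᗮ ↔ ∀ i, inner ℂ (e i) v = 0 := by
      intro v
      rw [Submodule.mem_orthogonal]
      constructor
      · intro h i
        exact h _ (Submodule.subset_span ⟨i, rfl⟩)
      · intro h u hu
        induction hu using Submodule.span_induction with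
        | mem x hx => obtain ⟨i, rfl⟩ := hx; exact h i
        | zero => simp
        | add x y _ _ h1 h2 => rw [inner_add_left, h1, h2, add_zero]
        | smul a x _ h1 => rw [inner_smul_left, h1, mul_zero]
    have hP' : Pᗮ ≠ ⊥ := by
      intro h
      have := Submodule.finrank_add_finrank_orthogonal P
      rw [h, hP] at this
      simp at this
      omega
    obtain ⟨z, w, u, hu, hu0, h1, h2⟩ := mvd_common Pᗮ hP' U.toLinearEquiv.toLinearMap
      V.toLinearEquiv.toLinearMap
      (by
        intro v hv
        rw [hmem] at hv ⊢
        intro i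
        obtain ⟨z, hz⟩ := (hev i).1
        exact mvd_orth_inv U _ _ z hz (he.1 i) (hv i))
      (by
        intro v hv
        rw [hmem] at hv ⊢
        intro i
        obtain ⟨z, hz⟩ := (hev i).2
        exact mvd_orth_inv V _ _ z hz (he.1 i) (hv i)) (fun v => hc v)
    rw [hmem] at hu
    have h1' : U u = z • u := h1
    have h2' : V u = w • u := h2
    let u' : E := ((‖u‖ : ℂ)⁻¹) • u
    have hn : ‖u'‖ = 1 := norm_smul_inv_norm hu0
    have hu1 : ∀ i, inner ℂ (e i) u' = 0 := fun i => by
      simp only [u', inner_smul_right, hu i, mul_zero]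
    refine ⟨Fin.cons u' e, ⟨?_, ?_⟩, ?_⟩
    · intro i
      refine Fin.cases ?_ (fun i => ?_) i
      · simpa using hn
      · simpa using he.1 i
    · intro i j
      refine Fin.cases ?_ (fun i => ?_) i <;> refine Fin.cases ?_ (fun j => ?_) j
      · intro h; exact absurd rfl h
      · intro _
        simp only [Fin.cons_zero, Fin.cons_succ]
        rw [← inner_conj_symm, hu1, map_zero]
      · intro _
        simp only [Fin.cons_zero, Fin.cons_succ]
        exact hu1 i
      · intro h
        simp only [Fin.cons_succ]
        exact he.2 (fun hh => h (by rw [hh]))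
    · intro i
      refine Fin.cases ?_ (fun i => ?_) i
      · simp only [Fin.cons_zero]
        refine ⟨⟨z, ?_⟩, ⟨w, ?_⟩⟩
        · simp only [u', map_smul, h1']; rw [smul_comm]
        · simp only [u', map_smul, h2']; rw [smul_comm]
      · simp only [Fin.cons_succ]
        exact hev i

lemma mvd_diag (U V : E ≃ₗᵢ[ℂ] E) (hc : ∀ v, U (V v) = V (U v)) (K : ℕ)
    (hK : finrank ℂ E = K) : ∃ (b : OrthonormalBasis (Fin K) ℂ E) (z w : Fin K → ℂ),
      ∀ i, U (b i) = z i • b i ∧ V (b i) = w i • b i ∧ ‖z i‖ = 1 ∧ ‖w i‖ = 1 := by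
  obtain ⟨e, he, hev⟩ := mvd_diag_aux U V hc K hK.ge
  obtain ⟨b, hb⟩ := Orthonormal.exists_orthonormalBasis_extension_of_card_eq (𝕜 := ℂ) (E := E)
    (ι := Fin K) (by simpa using hK) (v := e) (s := Set.univ)
    (he.comp (fun i : (Set.univ : Set (Fin K)) => (i : Fin K)) Subtype.val_injective)
  choose z hz using fun i => (hev i).1
  choose w hw using fun i => (hev i).2
  refine ⟨b, z, w, fun i => ?_⟩
  have hbi := hb i (Set.mem_univ i)
  rw [hbi]
  refine ⟨hz i, hw i, ?_, ?_⟩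
  · have := congrArg norm (hz i)
    rw [U.norm_map, norm_smul, he.1 i] at this
    linarith
  · have := congrArg norm (hw i)
    rw [V.norm_map, norm_smul, he.1 i] at this
    linarith

/-- Gram-equal families are related by a unitary. -/
lemma mvd_unitary {ι : Type*} [Finite ι] (a b : ι → E)
    (h : ∀ i j, inner ℂ (b i) (b j) = inner ℂ (a i) (a j)) :
    ∃ U : E ≃ₗᵢ[ℂ] E, ∀ i, U (a i) = b i := by
  classical
  have := Fintype.ofFinite ι
  let A := Fintype.linearCombination ℂ a
  let B := Fintype.linearCombination ℂ b
  have hn : ∀ c, ‖B c‖ = ‖A c‖ := by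
    intro c
    have : inner ℂ (B c) (B c) = inner ℂ (A c) (A c) := by
      simp only [A, B, Fintype.linearCombination_apply, sum_inner, inner_sum, inner_smul_left,
        inner_smul_right, h]
    rw [inner_self_eq_norm_sq_to_K, inner_self_eq_norm_sq_to_K] at this
    have h2 : ‖B c‖ ^ 2 = ‖A c‖ ^ 2 := by exact_mod_cast this
    exact (pow_left_inj₀ (norm_nonneg _) (norm_nonneg _) two_ne_zero).mp h2
  obtain ⟨g, hg⟩ := A.rangeRestrict.exists_rightInverse_of_surjective
    (LinearMap.range_rangeRestrict A)
  have hg' : ∀ y : LinearMap.range A, A (g y) = y := by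
    intro y
    have := congrArg (fun f => ((f y : LinearMap.range A) : E)) hg
    simpa using this
  let W : LinearMap.range A →ₗᵢ[ℂ] E :=
    { toLinearMap := B ∘ₗ g
      norm_map' := by
        intro y
        change ‖B (g y)‖ = ‖(y : E)‖
        rw [hn, hg'] }
  refine ⟨W.extend.toLinearIsometryEquiv rfl, fun i => ?_⟩
  have hai : A (Pi.single i 1) = a i := by simp [A, Fintype.linearCombination_apply_single]
  have hbi : B (Pi.single i 1) = b i := by simp [B, Fintype.linearCombination_apply_single]
  have h1 : W.extend (A (Pi.single i 1)) = W ⟨A (Pi.single i 1), ⟨_, rfl⟩⟩ :=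
    LinearIsometry.extend_apply W ⟨A (Pi.single i 1), ⟨_, rfl⟩⟩
  rw [LinearIsometry.coe_toLinearIsometryEquiv, ← hai, h1, ← hbi]
  change B (g _) = _
  rw [← sub_eq_zero, ← map_sub, ← norm_eq_zero, hn, map_sub, hg']
  simp

/-- Unitary with determinant one fixing a subspace of codimension at most one. -/
lemma mvd_fix (W : E ≃ₗᵢ[ℂ] E) (hdet : LinearMap.det W.toLinearEquiv.toLinearMap = 1)
    (M : Submodule ℂ E) (hM : finrank ℂ E ≤ finrank ℂ M + 1) (hfix : ∀ v ∈ M, W v = v) :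
    ∀ v, W v = v := by
  have h1 := Submodule.finrank_add_finrank_orthogonal M
  obtain ⟨u, hu⟩ := (finrank_le_one_iff (K := ℂ) (V := Mᗮ)).mp (by omega)
  by_cases hu0 : (u : E) = 0
  · have hb : Mᗮ = ⊥ := by
      rw [Submodule.eq_bot_iff]
      intro x hx
      obtain ⟨c, hc⟩ := hu ⟨x, hx⟩
      have := congrArg Subtype.val hc
      simp [hu0] at this
      exact this.symm
    intro v
    apply hfix
    rw [Submodule.orthogonal_eq_bot_iff.mp hb]
    trivial
  have hWu : W u ∈ Mᗮ := by
    rw [Submodule.mem_orthogonal]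
    intro m hm
    rw [← hfix m hm, W.inner_map_map]
    exact (Submodule.mem_orthogonal _ _).mp u.2 m hm
  obtain ⟨c, hc⟩ := hu ⟨W u, hWu⟩
  have hc : c • (u : E) = W u := congrArg Subtype.val hc
  let d : ℂ := inner ℂ (u : E) u
  have hd : d ≠ 0 := by simpa [d] using hu0
  let φ : Module.Dual ℂ E := d⁻¹ • (innerSL ℂ (u : E)).toLinearMap
  have hφu : φ u = 1 := by
    change d⁻¹ * d = 1
    exact inv_mul_cancel₀ hd
  have hW : W.toLinearEquiv.toLinearMap = LinearMap.transvection φ ((c - 1) • (u : E)) := by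
    ext v
    obtain ⟨m, hm, q, hq, rfl⟩ := Submodule.exists_add_mem_mem_orthogonal (K := M) v
    obtain ⟨t, ht⟩ := hu ⟨q, hq⟩
    have ht : t • (u : E) = q := congrArg Subtype.val ht
    have hφm : φ m = 0 := by
      change d⁻¹ * inner ℂ (u : E) m = 0
      rw [Submodule.inner_left_of_mem_orthogonal hm u.2, mul_zero]
    rw [LinearMap.transvection.apply, map_add φ, hφm, ← ht, map_smul, hφu]
    change W (m + t • (u : E)) = _
    rw [map_add, map_smul, hfix m hm, ← hc]
    simp only [smul_eq_mul]
    module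
  rw [hW, LinearMap.transvection.det, map_smul, hφu] at hdet
  have hc1 : c = 1 := by
    simp only [smul_eq_mul] at hdet
    linear_combination hdet
  intro v
  have := congrArg (fun f => f v) hW
  simpa [hc1, LinearMap.transvection.apply] using this


lemma mvd_chain (S : ℕ → Submodule ℂ E) (hmono : ∀ m, S m ≤ S (m + 1)) (L : ℕ)
    (hstab : ∀ m, m + 1 < L → S m = S (m + 1) → S (m + 1) = S (m + 2))
    (hne : S (L - 1) ≠ S L) (i j : ℕ) (hij : i ≤ j) (hj : j ≤ L) :
    finrank ℂ (S i) + (j - i) ≤ finrank ℂ (S j) := by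
  have key : ∀ m, m < L → S m ≠ S (m + 1) := by
    intro m hm heq
    have : ∀ k, m + k < L → S (m + k) = S (m + k + 1) := by
      intro k
      induction k with
      | zero => intro _; exact heq
      | succ k ih => intro hk; exact hstab (m + k) (by omega) (ih (by omega))
    have h := this (L - 1 - m) (by omega)
    rw [show m + (L - 1 - m) = L - 1 by omega, show L - 1 + 1 = L by omega] at h
    exact hne h
  obtain ⟨d, rfl⟩ := Nat.exists_eq_add_of_le hij
  clear hij
  induction d with
  | zero => simp
  | succ d ih =>
    have h1 := ih (by omega)
    have h2 : finrank ℂ (S (i + d)) < finrank ℂ (S (i + d + 1)) :=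
      Submodule.finrank_lt_finrank_of_lt (lt_of_le_of_ne (hmono _) (key _ (by omega)))
    rw [show i + (d + 1) = i + d + 1 by omega]
    omega

/-- span of a rectangular array of vectors -/
def mvdSp (x : ℕ → ℕ → E) (m n : ℕ) : Submodule ℂ E :=
  Submodule.span ℂ {v | ∃ l k, l < m ∧ k < n ∧ x l k = v}

lemma mvdSp_swap (x : ℕ → ℕ → E) (m n : ℕ) : mvdSp (fun a b => x b a) n m = mvdSp x m n := by
  unfold mvdSp
  congr 1
  ext v
  constructor
  · rintro ⟨l, k, h1, h2, h3⟩; exact ⟨k, l, h2, h1, h3⟩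
  · rintro ⟨l, k, h1, h2, h3⟩; exact ⟨k, l, h2, h1, h3⟩

lemma mvdSp_mem (x : ℕ → ℕ → E) {m n l k : ℕ} (h1 : l < m) (h2 : k < n) : x l k ∈ mvdSp x m n :=
  Submodule.subset_span ⟨l, k, h1, h2, rfl⟩

lemma mvdSp_mono (x : ℕ → ℕ → E) (m n : ℕ) : mvdSp x m n ≤ mvdSp x (m + 1) n := by
  unfold mvdSp
  apply Submodule.span_mono
  rintro v ⟨l, k, h1, h2, h3⟩
  exact ⟨l, k, by omega, h2, h3⟩

lemma mvdSp_stab (x : ℕ → ℕ → E) (L N : ℕ) (U : E ≃ₗᵢ[ℂ] E)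
    (hU : ∀ l n, l + 1 < L → n < N → U (x l n) = x (l + 1) n) (n : ℕ) (hn : n ≤ N)
    (m : ℕ) (hm : m + 1 < L) (h : mvdSp x m n = mvdSp x (m + 1) n) :
    mvdSp x (m + 1) n = mvdSp x (m + 2) n := by
  apply le_antisymm (mvdSp_mono x (m + 1) n)
  have hmap : ∀ v ∈ mvdSp x m n, U v ∈ mvdSp x (m + 1) n := by
    intro v hv
    unfold mvdSp at hv
    induction hv using Submodule.span_induction with
    | mem v hv =>
      obtain ⟨l, k, h1, h2, rfl⟩ := hv
      rw [hU l k (by omega) (by omega)]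
      exact mvdSp_mem x (by omega) h2
    | zero => simp
    | add a b _ _ h1 h2 => rw [map_add]; exact Submodule.add_mem _ h1 h2
    | smul c a _ h1 => rw [map_smul]; exact Submodule.smul_mem _ _ h1
  conv_lhs => unfold mvdSp
  rw [Submodule.span_le]
  rintro v ⟨l, k, h1, h2, rfl⟩
  rcases l with _ | l
  · exact mvdSp_mem x (by omega) h2
  · rw [← hU l k (by omega) (by omega)]
    apply hmap
    rw [h]
    exact mvdSp_mem x (by omega) h2

lemma mvd_shift (x : ℕ → ℕ → E) (L N : ℕ)
    (h1 : ∀ l l' n n', l + 1 < L → l' + 1 < L → n < N → n' < N →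
      inner ℂ (x (l + 1) n) (x (l' + 1) n') = inner ℂ (x l n) (x l' n')) :
    ∃ U : E ≃ₗᵢ[ℂ] E, ∀ l n, l + 1 < L → n < N → U (x l n) = x (l + 1) n := by
  obtain ⟨U, hU⟩ := mvd_unitary (ι := Fin (L - 1) × Fin N) (fun i => x i.1 i.2)
    (fun i => x (i.1 + 1) i.2) (by
      rintro ⟨i, j⟩ ⟨i', j'⟩
      exact h1 _ _ _ _ (by omega) (by omega) (by omega) (by omega))
  refine ⟨U, fun l n hl hn => ?_⟩
  exact hU (⟨l, by omega⟩, ⟨n, hn⟩)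

/-- If the first row spans a line, the second shift is a scalar. -/
lemma mvd_line (x : ℕ → ℕ → E) (L N : ℕ) (hL : 0 < L) (U V : E ≃ₗᵢ[ℂ] E)
    (hU : ∀ l n, l + 1 < L → n < N → U (x l n) = x (l + 1) n)
    (hV : ∀ l n, l < L → n + 1 < N → V (x l n) = x l (n + 1))
    (hd : finrank ℂ (mvdSp x 1 N) ≤ 1) :
    ∃ U V : E ≃ₗᵢ[ℂ] E, (∀ v, U (V v) = V (U v)) ∧
      (∀ l n, l + 1 < L → n < N → U (x l n) = x (l + 1) n) ∧
      (∀ l n, l < L → n + 1 < N → V (x l n) = x l (n + 1)) := by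
  by_cases hN : 1 < N
  swap
  · exact ⟨U, LinearIsometryEquiv.refl ℂ E, fun v => rfl, hU, fun l n _ h => by omega⟩
  have hw : ∃ w : ℂ, ‖w‖ = 1 ∧ x 0 1 = w • x 0 0 := by
    have hnorm : ‖x 0 1‖ = ‖x 0 0‖ := by rw [← hV 0 0 hL hN, V.norm_map]
    by_cases h0 : x 0 0 = 0
    · refine ⟨1, by simp, ?_⟩
      rw [h0, norm_zero, norm_eq_zero] at hnorm
      rw [h0, hnorm, smul_zero]
    obtain ⟨u, hu⟩ := finrank_le_one_iff.mp hd
    obtain ⟨a, ha⟩ := hu ⟨x 0 0, mvdSp_mem x (by omega) (by omega)⟩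
    obtain ⟨b, hb⟩ := hu ⟨x 0 1, mvdSp_mem x (by omega) (by omega)⟩
    have ha : a • (u : E) = x 0 0 := congrArg Subtype.val ha
    have hb : b • (u : E) = x 0 1 := congrArg Subtype.val hb
    have ha0 : a ≠ 0 := by rintro rfl; exact h0 (by rw [← ha, zero_smul])
    have he : x 0 1 = (b / a) • x 0 0 := by
      rw [← ha, ← hb, smul_smul, div_mul_cancel₀ _ ha0]
    refine ⟨b / a, ?_, he⟩
    rw [he, norm_smul] at hnorm
    have : ‖x 0 0‖ ≠ 0 := by simpa using h0
    exact mul_right_cancel₀ this (by rw [hnorm, one_mul])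
  obtain ⟨w, hw1, hw⟩ := hw
  have hrow : ∀ n, n + 1 < N → x 0 (n + 1) = w • x 0 n := by
    intro n
    induction n with
    | zero => intro _; exact hw
    | succ n ih =>
      intro hn
      rw [← hV 0 (n + 1) hL hn, ih (by omega), map_smul, hV 0 n hL (by omega), ih (by omega)]
  have hall : ∀ l n, l < L → n + 1 < N → x l (n + 1) = w • x l n := by
    intro l
    induction l with
    | zero => intro n _ hn; exact hrow n hn
    | succ l ih =>
      intro n hl hn
      rw [← hU l (n + 1) hl hn, ih n (by omega) hn, map_smul, hU l n hl (by omega)]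
  let Y : E →ₗᵢ[ℂ] E :=
    { toLinearMap := w • LinearMap.id
      norm_map' := by
        intro v
        change ‖w • v‖ = ‖v‖
        rw [norm_smul, hw1, one_mul] }
  have hY : ∀ v, Y.toLinearIsometryEquiv rfl v = w • v := fun v => rfl
  refine ⟨U, Y.toLinearIsometryEquiv rfl, ?_, hU, ?_⟩
  · intro v; rw [hY, hY, map_smul]
  · intro l n hl hn; rw [hY, hall l n hl hn]

lemma mvd_commuting (x : ℕ → ℕ → E) (L N : ℕ) (hL : 0 < L) (hN : 0 < N)
    (h1 : ∀ l l' n n', l + 1 < L → l' + 1 < L → n < N → n' < N →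
      inner ℂ (x (l + 1) n) (x (l' + 1) n') = inner ℂ (x l n) (x l' n'))
    (h2 : ∀ l l' n n', l < L → l' < L → n + 1 < N → n' + 1 < N →
      inner ℂ (x l (n + 1)) (x l' (n' + 1)) = inner ℂ (x l n) (x l' n'))
    (hspan : mvdSp x L N = ⊤) (hKL : finrank ℂ E ≤ L) (hKN : finrank ℂ E ≤ N) :
    ∃ U V : E ≃ₗᵢ[ℂ] E, (∀ v, U (V v) = V (U v)) ∧
      (∀ l n, l + 1 < L → n < N → U (x l n) = x (l + 1) n) ∧
      (∀ l n, l < L → n + 1 < N → V (x l n) = x l (n + 1)) := by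
  obtain ⟨U, hU⟩ := mvd_shift x L N h1
  obtain ⟨V, hV'⟩ := mvd_shift (fun a b => x b a) N L
    (fun l l' n n' a b c d => h2 n n' l l' c d a b)
  have hV : ∀ l n, l < L → n + 1 < N → V (x l n) = x l (n + 1) := fun l n a b => hV' n l b a
  have htop : finrank ℂ (mvdSp x L N) = finrank ℂ E := by rw [hspan, finrank_top]
  by_cases hA : mvdSp x (L - 1) N = mvdSp x L N
  swap
  · have := mvd_chain (fun m => mvdSp x m N) (fun m => mvdSp_mono x m N) L
      (fun m hm h => mvdSp_stab x L N U hU N le_rfl m hm h) hA 1 L hL le_rfl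
    exact mvd_line x L N hL U V hU hV (by omega)
  by_cases hB : mvdSp x L (N - 1) = mvdSp x L N
  swap
  · have := mvd_chain (fun m => mvdSp (fun a b => x b a) m L)
      (fun m => mvdSp_mono _ m L) N
      (fun m hm h => mvdSp_stab _ N L V hV' L le_rfl m hm h)
      (by simpa only [mvdSp_swap] using hB) 1 N hN le_rfl
    obtain ⟨A, B, c1, c2, c3⟩ := mvd_line (fun a b => x b a) N L hN V U hV'
      (fun l n a b => hU n l b a)
      (by rw [mvdSp_swap x L N] at this; omega)
    exact ⟨B, A, fun v => (c1 v).symm, fun l n a b => c3 n l b a, fun l n a b => c2 n l b a⟩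
  have hM : finrank ℂ E ≤ finrank ℂ (mvdSp x (L - 1) (N - 1)) + 1 := by
    by_cases hC : mvdSp x (L - 1) (N - 1) = mvdSp x (L - 1) N
    · rw [hC, hA]; omega
    · have := mvd_chain (fun m => mvdSp (fun a b => x b a) m (L - 1))
        (fun m => mvdSp_mono _ m _) N
        (fun m hm h => mvdSp_stab _ N L V hV' (L - 1) (by omega) m hm h)
        (by simpa only [mvdSp_swap] using hC) 0 (N - 1) (by omega) (by omega)
      rw [mvdSp_swap x (L - 1) (N - 1)] at this
      omega
  refine ⟨U, V, ?_, hU, hV⟩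
  let P : E ≃ₗᵢ[ℂ] E := V.trans U
  let Q : E ≃ₗᵢ[ℂ] E := U.trans V
  let W : E ≃ₗᵢ[ℂ] E := P.trans Q.symm
  have hfix : ∀ v ∈ mvdSp x (L - 1) (N - 1), W v = v := by
    intro v hv
    unfold mvdSp at hv
    induction hv using Submodule.span_induction with
    | mem v hv =>
      obtain ⟨l, k, h1, h2, rfl⟩ := hv
      change Q.symm (U (V (x l k))) = x l k
      rw [LinearIsometryEquiv.symm_apply_eq]
      change _ = V (U (x l k))
      rw [hV l k (by omega) (by omega), hU l k (by omega) (by omega),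
        hU l _ (by omega) (by omega), hV _ k (by omega) (by omega)]
    | zero => simp
    | add a b _ _ h1 h2 => rw [map_add, h1, h2]
    | smul c a _ h1 => rw [map_smul, h1]
  have hdet : LinearMap.det W.toLinearEquiv.toLinearMap = 1 := by
    have e1 : P.toLinearEquiv.toLinearMap = Q.toLinearEquiv.toLinearMap ∘ₗ
        W.toLinearEquiv.toLinearMap := by
      ext v
      change P v = Q (Q.symm (P v))
      simp
    have e2 : P.toLinearEquiv.toLinearMap = U.toLinearEquiv.toLinearMap ∘ₗ
        V.toLinearEquiv.toLinearMap := rfl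
    have e3 : Q.toLinearEquiv.toLinearMap = V.toLinearEquiv.toLinearMap ∘ₗ
        U.toLinearEquiv.toLinearMap := rfl
    have d1 := congrArg LinearMap.det e1
    have hQ0 : LinearMap.det Q.toLinearEquiv.toLinearMap ≠ 0 :=
      (LinearEquiv.isUnit_det' Q.toLinearEquiv).ne_zero
    have hPQ : LinearMap.det P.toLinearEquiv.toLinearMap =
        LinearMap.det Q.toLinearEquiv.toLinearMap := by
      rw [e2, e3, LinearMap.det_comp, LinearMap.det_comp, mul_comm]
    rw [LinearMap.det_comp, hPQ] at d1
    exact mul_left_cancel₀ hQ0 (by rw [← d1, mul_one])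
  intro v
  have hv := mvd_fix W hdet _ hM hfix v
  have : Q.symm (P v) = v := hv
  rw [LinearIsometryEquiv.symm_apply_eq] at this
  exact this

lemma mvd_apply (x : ℕ → ℕ → E) (L N K : ℕ) (hL : 0 < L) (hN : 0 < N) (U V : E ≃ₗᵢ[ℂ] E)
    (hU : ∀ l n, l + 1 < L → n < N → U (x l n) = x (l + 1) n)
    (hV : ∀ l n, l < L → n + 1 < N → V (x l n) = x l (n + 1))
    (b : OrthonormalBasis (Fin K) ℂ E) (z w : Fin K → ℂ)
    (hb : ∀ i, U (b i) = z i • b i ∧ V (b i) = w i • b i ∧ ‖z i‖ = 1 ∧ ‖w i‖ = 1) (i : Fin K) :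
    ∀ l n, l < L → n < N → inner ℂ (b i) (x l n) = z i ^ l * w i ^ n * inner ℂ (b i) (x 0 0) := by
  have step : ∀ (A : E ≃ₗᵢ[ℂ] E) (c : ℂ) (v : E), A (b i) = c • b i → ‖c‖ = 1 →
      inner ℂ (b i) (A v) = c * inner ℂ (b i) v := by
    intro A c v hA hc
    have h := A.inner_map_map (b i) v
    rw [hA, inner_smul_left] at h
    rw [← h, ← mul_assoc, Complex.mul_conj, Complex.normSq_eq_norm_sq, hc]
    simp
  intro l
  induction l with
  | zero =>
    intro n
    induction n with
    | zero => intros; simp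
    | succ n ih =>
      intro h1 h2
      rw [← hV 0 n h1 h2, step V (w i) _ (hb i).2.1 (hb i).2.2.2, ih h1 (by omega)]
      ring
  | succ l ih =>
    intro n h1 h2
    rw [← hU l n h1 h2, step U (z i) _ (hb i).1 (hb i).2.2.1, ih n (by omega) h2]
    ring

lemma mvd_gram (x : ℕ → ℕ → E) (L N K : ℕ) (hL : 0 < L) (hN : 0 < N)
    (h1 : ∀ l l' n n', l + 1 < L → l' + 1 < L → n < N → n' < N →
      inner ℂ (x (l + 1) n) (x (l' + 1) n') = inner ℂ (x l n) (x l' n'))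
    (h2 : ∀ l l' n n', l < L → l' < L → n + 1 < N → n' + 1 < N →
      inner ℂ (x l (n + 1)) (x l' (n' + 1)) = inner ℂ (x l n) (x l' n'))
    (hspan : mvdSp x L N = ⊤) (hK : finrank ℂ E = K) (hKL : K ≤ L) (hKN : K ≤ N) :
    ∃ (z w : Fin K → ℂ) (p : Fin K → ℝ), (∀ i, ‖z i‖ = 1) ∧ (∀ i, ‖w i‖ = 1) ∧
      (∀ i, 0 < p i) ∧ Function.Injective (fun i => (z i, w i)) ∧
      ∀ l l' n n', l < L → l' < L → n < N → n' < N → inner ℂ (x l n) (x l' n') =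
        ∑ i, (p i : ℂ) * (star (z i ^ l * w i ^ n) * (z i ^ l' * w i ^ n')) := by
  obtain ⟨U, V, hc, hU, hV⟩ := mvd_commuting x L N hL hN h1 h2 hspan (by omega) (by omega)
  obtain ⟨b, z, w, hb⟩ := mvd_diag U V hc K hK
  have happ := mvd_apply x L N K hL hN U V hU hV b z w hb
  -- a vector orthogonal to all the `x l n` is zero
  have hzero : ∀ v : E, (∀ l n, l < L → n < N → inner ℂ v (x l n) = 0) → v = 0 := by
    intro v hv
    have : ∀ y ∈ mvdSp x L N, inner ℂ v y = 0 := by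
      intro y hy
      unfold mvdSp at hy
      induction hy using Submodule.span_induction with
      | mem y hy => obtain ⟨l, k, a1, a2, rfl⟩ := hy; exact hv l k a1 a2
      | zero => simp
      | add a c _ _ e1 e2 => rw [inner_add_right, e1, e2, add_zero]
      | smul c a _ e1 => rw [inner_smul_right, e1, mul_zero]
    rw [hspan] at this
    exact inner_self_eq_zero.mp (this v trivial)
  have hc0 : ∀ i, inner ℂ (b i) (x 0 0) ≠ 0 := by
    intro i hi
    have := hzero (b i) (fun l n a1 a2 => by rw [happ i l n a1 a2, hi, mul_zero])
    have hn := b.orthonormal.1 i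
    rw [this] at hn
    simp at hn
  refine ⟨z, w, fun i => ‖inner ℂ (b i) (x 0 0)‖ ^ 2, fun i => (hb i).2.2.1,
    fun i => (hb i).2.2.2, fun i => ?_, ?_, ?_⟩
  · have := hc0 i
    positivity
  · intro i j hij
    simp only [Prod.mk.injEq] at hij
    by_contra hne
    set ci := inner ℂ (b i) (x 0 0) with hci
    set cj := inner ℂ (b j) (x 0 0) with hcj
    have := hzero (star cj • b i - star ci • b j) (fun l n a1 a2 => by
      rw [inner_sub_left, inner_smul_left, inner_smul_left, happ i l n a1 a2,
        happ j l n a1 a2, hij.1, hij.2, ← hci, ← hcj]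
      simp
      ring)
    have h3 := congrArg (fun v => inner ℂ (b i) v) this
    simp only [inner_sub_right, inner_smul_right, inner_zero_right] at h3
    rw [b.orthonormal.2 hne, inner_self_eq_norm_sq_to_K, b.orthonormal.1 i] at h3
    simp at h3
    exact hc0 j h3
  · intro l l' n n' a1 a2 a3 a4
    rw [← b.sum_inner_mul_inner]
    refine Finset.sum_congr rfl fun i _ => ?_
    rw [← inner_conj_symm, happ i l n a1 a3, happ i l' n' a2 a4]
    have : ((‖inner ℂ (b i) (x 0 0)‖ ^ 2 : ℝ) : ℂ) =
        (starRingEnd ℂ) (inner ℂ (b i) (x 0 0)) * inner ℂ (b i) (x 0 0) := by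
      rw [Complex.conj_mul']; push_cast; rfl
    rw [this, map_mul]
    simp only [Complex.star_def]
    ring

end MVD

lemma mvd_freq (z : ℂ) (hz : ‖z‖ = 1) : ∃ f : ℝ, f ∈ Set.Ico (0 : ℝ) 1 ∧
    star z = Complex.exp (2 * (Real.pi : ℂ) * Complex.I * (f : ℝ)) := by
  have h1 : ‖star z‖ = 1 := by rw [norm_star, hz]
  let t : ℝ := (star z).arg / (2 * Real.pi)
  refine ⟨Int.fract t, ⟨Int.fract_nonneg _, Int.fract_lt_one _⟩, ?_⟩
  have h2 := Complex.norm_mul_exp_arg_mul_I (star z)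
  rw [h1] at h2
  have hpi : (Real.pi : ℂ) ≠ 0 := by exact_mod_cast Real.pi_ne_zero
  rw [← h2]
  have : ((Int.fract t : ℝ) : ℂ) = (t : ℂ) - (⌊t⌋ : ℤ) := by
    rw [Int.fract]; push_cast; rfl
  rw [this]
  simp only [Complex.ofReal_one, one_mul]
  rw [Complex.exp_eq_exp_iff_exists_int]
  refine ⟨⌊t⌋, ?_⟩
  have ht : (t : ℂ) = ((star z).arg : ℂ) / (2 * (Real.pi : ℂ)) := by
    simp only [t]; push_cast; rfl
  rw [ht]
  field_simp
  ring

lemma mvd_steer (m : ℕ) (f : ℝ) (z : ℂ)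
    (h : star z = Complex.exp (2 * (Real.pi : ℂ) * Complex.I * (f : ℝ))) (j : Fin m) :
    steer m f j = star (z ^ (j : ℕ)) := by
  rw [star_pow, h, ← Complex.exp_nat_mul]
  unfold steer
  congr 1
  ring

lemma mvd_factor {ι : Type*} [Fintype ι] [DecidableEq ι] (T : Matrix ι ι ℂ)
    (hT : T.IsHermitian) (σ : ℝ) (hσ : ∀ i, σ ≤ hT.eigenvalues i) :
    ∃ B : Matrix ι ι ℂ, T - (σ : ℂ) • (1 : Matrix ι ι ℂ) = Bᴴ * B := by
  let U : Matrix ι ι ℂ := (hT.eigenvectorUnitary : Matrix ι ι ℂ)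
  have hUU : U * Uᴴ = 1 := Unitary.mul_star_self_of_mem hT.eigenvectorUnitary.2
  have hs : T = U * diagonal (fun i => (hT.eigenvalues i : ℂ)) * Uᴴ := by
    have := hT.spectral_theorem
    rw [Unitary.conjStarAlgAut_apply] at this
    exact this
  refine ⟨diagonal (fun i => ((Real.sqrt (hT.eigenvalues i - σ) : ℝ) : ℂ)) * Uᴴ, ?_⟩
  have h1 : (σ : ℂ) • (1 : Matrix ι ι ℂ) = U * diagonal (fun _ => (σ : ℂ)) * Uᴴ := by
    rw [← smul_one_eq_diagonal, Matrix.mul_smul, Matrix.mul_one, Matrix.smul_mul, hUU]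
  have h2 : diagonal (fun i => (hT.eigenvalues i : ℂ)) - diagonal (fun _ => (σ : ℂ)) =
      (diagonal (fun i => ((Real.sqrt (hT.eigenvalues i - σ) : ℝ) : ℂ)))ᴴ *
      diagonal (fun i => ((Real.sqrt (hT.eigenvalues i - σ) : ℝ) : ℂ)) := by
    rw [diagonal_conjTranspose, diagonal_mul_diagonal, diagonal_sub]
    congr 1
    ext i
    simp only [Pi.star_apply, Complex.star_def, Complex.conj_ofReal]
    rw [← Complex.ofReal_mul, Real.mul_self_sqrt (sub_nonneg.mpr (hσ i))]
    push_cast; rfl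
  rw [conjTranspose_mul, conjTranspose_conjTranspose, h1]
  conv_lhs => rw [hs]
  rw [← Matrix.sub_mul, ← Matrix.mul_sub, h2]
  simp only [Matrix.mul_assoc]

/-- Multiple Vandermonde decomposition (existence part of Theorem 1): a PSD
Toeplitz-block-Toeplitz matrix `T ∈ ℂ^{NL×NL}` with smallest eigenvalue `σ` and
`K = rank(T − σI) ≤ min{N,L}` decomposes as
`T = Σ_k p_k (v_L(f_k)v_L(f_k)ᴴ) ⊗ (v_N(θ_k)v_N(θ_k)ᴴ) + σI` with pairwise distinct
pairs `(f_k, θ_k) ∈ [0,1)²` and positive weights `p_k`. -/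
theorem multiple_vandermonde_decomposition_exists
    (N L : ℕ) (hN : 0 < N) (hL : 0 < L)
    (T : Matrix (Fin L × Fin N) (Fin L × Fin N) ℂ)
    (hT : T.PosSemidef) (hTBT : IsToeplitzBlockToeplitz T)
    (σ : ℝ) (hσ : IsLeast (Set.range hT.isHermitian.eigenvalues) σ)
    (K : ℕ) (hK : K = (T - (σ : ℂ) • (1 : Matrix (Fin L × Fin N) (Fin L × Fin N) ℂ)).rank)
    (hKmin : K ≤ min N L) :
    ∃ (f θ p : Fin K → ℝ),
      (∀ k, f k ∈ Set.Ico (0 : ℝ) 1) ∧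
      (∀ k, θ k ∈ Set.Ico (0 : ℝ) 1) ∧
      Function.Injective (fun k => (f k, θ k)) ∧
      (∀ k, 0 < p k) ∧
      T = ∑ k, (p k : ℂ) • (steerMat L (f k) ⊗ₖ steerMat N (θ k))
            + (σ : ℂ) • (1 : Matrix (Fin L × Fin N) (Fin L × Fin N) ℂ) := by
  obtain ⟨B, hB⟩ := mvd_factor T hT.isHermitian σ (fun i => hσ.2 ⟨i, rfl⟩)
  set S := T - (σ : ℂ) • (1 : Matrix (Fin L × Fin N) (Fin L × Fin N) ℂ) with hS
  have hStoep : IsToeplitzBlockToeplitz S := by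
    intro i j i' j' h1 h2
    have h3 : i = j ↔ i' = j' := by
      rw [Prod.ext_iff, Prod.ext_iff, Fin.ext_iff, Fin.ext_iff, Fin.ext_iff, Fin.ext_iff]
      omega
    simp only [hS, Matrix.sub_apply, Matrix.smul_apply, Matrix.one_apply, h3,
      hTBT i j i' j' h1 h2]
  let c : Fin L × Fin N → EuclideanSpace ℂ (Fin L × Fin N) :=
    fun j => (WithLp.linearEquiv 2 ℂ (Fin L × Fin N → ℂ)).symm (B.col j)
  have hcin : ∀ i j, inner ℂ (c i) (c j) = S i j := by
    intro i j
    rw [hB, Matrix.mul_apply, PiLp.inner_apply]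
    refine Finset.sum_congr rfl fun k _ => ?_
    simp [c, Matrix.col, mul_comm]
  let E := Submodule.span ℂ (Set.range c)
  have hE : Module.finrank ℂ E = K := by
    rw [hK, hB, Matrix.rank_conjTranspose_mul_self, Matrix.rank_eq_finrank_span_cols]
    have : E = (Submodule.span ℂ (Set.range B.col)).map
        (WithLp.linearEquiv 2 ℂ (Fin L × Fin N → ℂ)).symm.toLinearMap := by
      rw [Submodule.map_span, ← Set.range_comp]
      rfl
    rw [this]
    exact LinearEquiv.finrank_map_eq _ _
  let x : ℕ → ℕ → E := fun l n =>
    if h : l < L ∧ n < N then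
      ⟨c (⟨l, h.1⟩, ⟨n, h.2⟩), Submodule.subset_span ⟨_, rfl⟩⟩ else 0
  have hx : ∀ l n (hl : l < L) (hn : n < N), (x l n : EuclideanSpace ℂ (Fin L × Fin N)) =
      c (⟨l, hl⟩, ⟨n, hn⟩) := by
    intro l n hl hn
    simp [x, hl, hn]
  have hxin : ∀ l l' n n' (hl : l < L) (hl' : l' < L) (hn : n < N) (hn' : n' < N),
      inner ℂ (x l n) (x l' n') = S (⟨l, hl⟩, ⟨n, hn⟩) (⟨l', hl'⟩, ⟨n', hn'⟩) := by
    intro l l' n n' hl hl' hn hn'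
    rw [Submodule.coe_inner, hx l n hl hn, hx l' n' hl' hn', hcin]
  have hspan : mvdSp x L N = ⊤ := by
    apply Submodule.map_injective_of_injective E.injective_subtype
    rw [Submodule.map_top, Submodule.range_subtype]
    unfold mvdSp
    rw [Submodule.map_span]
    change Submodule.span ℂ _ = Submodule.span ℂ (Set.range c)
    congr 1
    ext v
    constructor
    · rintro ⟨_, ⟨l, n, hl, hn, rfl⟩, rfl⟩
      exact ⟨_, (hx l n hl hn).symm⟩
    · rintro ⟨⟨l, n⟩, rfl⟩
      exact ⟨x l n, ⟨l, n, l.2, n.2, rfl⟩, hx l n l.2 n.2⟩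
  obtain ⟨z, w, p, hz, hw, hp, hinj, hsum⟩ := mvd_gram x L N K hL hN
    (fun l l' n n' a1 a2 a3 a4 => by
      rw [hxin _ _ _ _ a1 a2 a3 a4, hxin l l' n n' (by omega) (by omega) a3 a4]
      apply hStoep
      · push_cast; ring
      · rfl)
    (fun l l' n n' a1 a2 a3 a4 => by
      rw [hxin _ _ _ _ a1 a2 a3 a4, hxin l l' n n' a1 a2 (by omega) (by omega)]
      apply hStoep
      · rfl
      · push_cast; ring)
    hspan hE (hKmin.trans (min_le_right _ _)) (hKmin.trans (min_le_left _ _))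
  choose f hf hfz using fun i => mvd_freq (z i) (hz i)
  choose θ hθ hθw using fun i => mvd_freq (w i) (hw i)
  refine ⟨f, θ, p, hf, hθ, ?_, hp, ?_⟩
  · intro i j hij
    simp only [Prod.mk.injEq] at hij
    apply hinj
    simp only [Prod.mk.injEq]
    constructor
    · apply star_injective
      rw [hfz, hfz, hij.1]
    · apply star_injective
      rw [hθw, hθw, hij.2]
  · rw [← sub_eq_iff_eq_add, ← hS]
    ext ⟨l, n⟩ ⟨l', n'⟩
    rw [← hxin l l' n n' l.2 l'.2 n.2 n'.2, hsum _ _ _ _ l.2 l'.2 n.2 n'.2, Matrix.sum_apply]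
    refine Finset.sum_congr rfl fun k _ => ?_
    rw [Matrix.smul_apply, Matrix.kroneckerMap_apply]
    simp only [steerMat, Matrix.vecMulVec_apply, Pi.star_apply, smul_eq_mul,
      mvd_steer _ _ _ (hfz k), mvd_steer _ _ _ (hθw k), star_star, star_mul]
    ring
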